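/- arXiv:2108.07146 — 5 statements merged into one kernel-verified Lean document; each statement's English description precedes it below -/
import Mathlib

section
/- (Key inequality in the proof of Proposition 3(iv): trading up all remaining consumers dominates partial trading up.) Let δ ∈ (0,1) and let Δ ≥ 1 and Δ⁺ ≥ 0 be real numbers with δ·Δ⁺ = Δ − 1. Let λ ∈ (0,1), φ ∈ [0,1], ω > 0, ε ≥ 0, and let v̄, v_i, v_j, Π*, Π̄ be real numbers satisfying: (a) v̄ ≤ ε + v_i; (b) Π* < λ·ω·v̄·Δ + δ·(1−λ)·ω·v̄·Δ⁺; (c) Π̄ ≥ (1−φ)·ω·v_i·Δ + φ·ω·v_j·Δ. If ε ≤ ((1−λ)·v_i + φ·Δ·(v_j − v_i)) / (Δ − 1 + λ), then Π̄ > Π*. -/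
/-- Key inequality in the proof of Proposition 3(iv): trading up all remaining
consumers dominates partial trading up. -/
theorem trading_up_all_dominates (δ Δ Δp lam φ ω ε vbar vi vj Pstar Pbar : ℝ)
    (hδ : δ ∈ Set.Ioo (0:ℝ) 1) (hΔ : 1 ≤ Δ) (hΔp : 0 ≤ Δp)
    (hrel : δ * Δp = Δ - 1)
    (hlam : lam ∈ Set.Ioo (0:ℝ) 1) (hφ : φ ∈ Set.Icc (0:ℝ) 1)
    (hω : 0 < ω) (hε : 0 ≤ ε)
    (ha : vbar ≤ ε + vi)
    (hb : Pstar < lam * ω * vbar * Δ + δ * (1 - lam) * ω * vbar * Δp)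
    (hc : Pbar ≥ (1 - φ) * ω * vi * Δ + φ * ω * vj * Δ)
    (hεbound : ε ≤ ((1 - lam) * vi + φ * Δ * (vj - vi)) / (Δ - 1 + lam)) :
    Pbar > Pstar := by
  have hD : 0 < Δ - 1 + lam := by linarith [hlam.1]
  rw [le_div_iff₀ hD] at hεbound
  have hvbar : vbar * (Δ - 1 + lam) ≤ (ε + vi) * (Δ - 1 + lam) :=
    mul_le_mul_of_nonneg_right ha hD.le
  have hsurplus : vbar * (Δ - 1 + lam) ≤ (1 - φ) * vi * Δ + φ * vj * Δ := by linarith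
  calc Pstar < lam * ω * vbar * Δ + δ * (1 - lam) * ω * vbar * Δp := hb
    _ = ω * (vbar * (Δ - 1 + lam)) := by linear_combination (1 - lam) * ω * vbar * hrel
    _ ≤ ω * ((1 - φ) * vi * Δ + φ * vj * Δ) := mul_le_mul_of_nonneg_left hsurplus hω.le
    _ = (1 - φ) * ω * vi * Δ + φ * ω * vj * Δ := by ring
    _ ≤ Pbar := hc
end

section
/- (Characterization of price profiles leaving no trading-up opportunities: two rentals with full support.) For p = (p_a, p_b) ∈ ℝ² and v = (v_a, v_b) ∈ [0,1]², define the static utilities u_a = v_a − p_a, u_b = v_b − p_b, u_o = 0 and the state values w_a = v_a, w_b = v_b, w_o = 0. Call v misallocated at p if there is a unique s ∈ {a, b, o} with u_s > u_{s′} for both s′ ≠ s, and w_s < max{w_a, w_b, w_o}. Then the two-dimensional Lebesgue measure of the set of misallocated v in [0,1]² is zero if and only if p_a = p_b and p_a ≤ 0. -/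
open MeasureTheory

theorem volume_ne_zero_of_Ioo_prod_Ioo_subset {S : Set (ℝ × ℝ)} {a b c d : ℝ}
    (hab : a < b) (hcd : c < d) (h : Set.Ioo a b ×ˢ Set.Ioo c d ⊆ S) : volume S ≠ 0 := by
  have hU : IsOpen (Set.Ioo a b ×ˢ Set.Ioo c d) := isOpen_Ioo.prod isOpen_Ioo
  have hne : (Set.Ioo a b ×ˢ Set.Ioo c d).Nonempty :=
    (Set.nonempty_Ioo.2 hab).prod (Set.nonempty_Ioo.2 hcd)
  exact ((hU.measure_pos volume hne).trans_le (measure_mono h)).ne'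

/-- Characterization of price profiles leaving no trading-up opportunities:
two rentals with full support on the unit square. A type `v` is misallocated at
`p` if it has a unique static strict optimum `s ∈ {a,b,o}` whose state value is
strictly below the maximum state value `max {v_a, v_b, 0}`. -/
theorem no_tuo_two_rentals (pa pb : ℝ) :
    volume {v : ℝ × ℝ | (v.1 ∈ Set.Icc (0:ℝ) 1 ∧ v.2 ∈ Set.Icc (0:ℝ) 1) ∧
      ((v.1 - pa > v.2 - pb ∧ v.1 - pa > 0 ∧ v.1 < max v.1 (max v.2 0)) ∨
        (v.2 - pb > v.1 - pa ∧ v.2 - pb > 0 ∧ v.2 < max v.1 (max v.2 0)) ∨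
        ((0:ℝ) > v.1 - pa ∧ (0:ℝ) > v.2 - pb ∧ (0:ℝ) < max v.1 (max v.2 0)))} = 0
    ↔ (pa = pb ∧ pa ≤ 0) := by
  constructor
  · contrapose!
    intro hp
    by_cases hpos : 0 < pa ∧ 0 < pb
    · obtain ⟨ha, hb⟩ := hpos
      refine volume_ne_zero_of_Ioo_prod_Ioo_subset (lt_min ha one_pos) (lt_min hb one_pos) ?_
      rintro ⟨x, y⟩ ⟨⟨hx0, hx⟩, hy0, hy⟩
      simp only [lt_min_iff] at hx0 hx hy0 hy
      exact ⟨⟨⟨hx0.le, hx.2.le⟩, hy0.le, hy.2.le⟩,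
        Or.inr (Or.inr ⟨sub_neg.2 hx.1, sub_neg.2 hy.1, lt_max_of_lt_left hx0⟩)⟩
    · rcases lt_trichotomy pa pb with hlt | heq | hlt
      · have ha : pa ≤ 0 := not_lt.1 fun h => hpos ⟨h, h.trans hlt⟩
        obtain ⟨d, hd0, hd⟩ := exists_between (lt_min (sub_pos.2 hlt) one_pos)
        obtain ⟨hd, hd1⟩ := lt_min_iff.1 hd
        refine volume_ne_zero_of_Ioo_prod_Ioo_subset (half_pos hd0) (half_lt_self hd0) ?_
        rintro ⟨x, y⟩ ⟨⟨hx0, hx⟩, hy0, hy⟩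
        dsimp only at hx0 hx hy0 hy
        refine ⟨⟨⟨?_, ?_⟩, ?_, ?_⟩,
          Or.inl ⟨?_, ?_, lt_max_of_lt_right (lt_max_of_lt_left ?_)⟩⟩ <;> dsimp only <;> linarith
      · exact absurd ⟨hp heq, heq ▸ hp heq⟩ hpos
      · have hb : pb ≤ 0 := not_lt.1 fun h => hpos ⟨h.trans hlt, h⟩
        obtain ⟨d, hd0, hd⟩ := exists_between (lt_min (sub_pos.2 hlt) one_pos)
        obtain ⟨hd, hd1⟩ := lt_min_iff.1 hd
        refine volume_ne_zero_of_Ioo_prod_Ioo_subset (half_lt_self hd0) (half_pos hd0) ?_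
        rintro ⟨x, y⟩ ⟨⟨hx0, hx⟩, hy0, hy⟩
        dsimp only at hx0 hx hy0 hy
        refine ⟨⟨⟨?_, ?_⟩, ?_, ?_⟩,
          Or.inr (Or.inl ⟨?_, ?_, lt_max_of_lt_left ?_⟩)⟩ <;> dsimp only <;> linarith
  · rintro ⟨rfl, hp⟩
    convert measure_empty (μ := (volume : Measure (ℝ × ℝ)))
    refine Set.eq_empty_iff_forall_notMem.2 ?_
    rintro ⟨x, y⟩ ⟨⟨⟨hx, -⟩, hy, -⟩, ⟨h, -, hlt⟩ | ⟨h, -, hlt⟩ | ⟨h, -, -⟩⟩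
    · simp only [lt_max_iff] at hx hy h hlt
      rcases hlt with hlt | hlt | hlt <;> linarith
    · simp only [lt_max_iff] at hx hy h hlt
      rcases hlt with hlt | hlt | hlt <;> linarith
    · dsimp only at hx h
      linarith
end

section
/- (Characterization of price profiles leaving no trading-up opportunities: mixed varieties with full support.) Consider the mixed setting with rental variety a, durable (absorbing) variety b, and initial state o, where the admissible transitions out of consumption states are (a,o), (a,b) and out of o are (o,a), (o,b). For p = (p_a, p_b) ∈ ℝ² and v = (v_a, v_b) ∈ [0,1]², define u_a = v_a − p_a, u_b = v_b − p_b, u_o = 0. Call v a trading-up type at p if there is a unique s ∈ {a, b, o} with u_s > u_{s′} for both s′ ≠ s, and either (s = a and v_b > v_a) or (s = o and max{v_a, v_b} > 0). Then the two-dimensional Lebesgue measure of the set of trading-up types in [0,1]² is zero if and only if p_b ≤ 0 and p_a ≥ p_b. -/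
open MeasureTheory

/-- A planar set containing a nondegenerate open box has nonzero area. -/
theorem volume_ne_zero_of_Ioo_prod_subset {s : Set (ℝ × ℝ)} {a b c d : ℝ} (hab : a < b)
    (hcd : c < d) (h : Set.Ioo a b ×ˢ Set.Ioo c d ⊆ s) : volume s ≠ 0 :=
  (((isOpen_Ioo.prod isOpen_Ioo).measure_pos volume
    ((Set.nonempty_Ioo.2 hab).prod (Set.nonempty_Ioo.2 hcd))).trans_le (measure_mono h)).ne'

/-- Characterization of price profiles leaving no trading-up opportunities:
mixed varieties (rental `a`, durable `b`) with full support on the unit square.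
A type `v` is a trading-up type at `p` if its unique static strict optimum is
`a` while it strictly prefers `b` by value, or is the outside option `o` while
some variety has strictly positive value. -/
theorem no_tuo_mixed_varieties (pa pb : ℝ) :
    volume {v : ℝ × ℝ | (v.1 ∈ Set.Icc (0:ℝ) 1 ∧ v.2 ∈ Set.Icc (0:ℝ) 1) ∧
      ((v.1 - pa > v.2 - pb ∧ v.1 - pa > 0 ∧ v.2 > v.1) ∨
        ((0:ℝ) > v.1 - pa ∧ (0:ℝ) > v.2 - pb ∧ max v.1 v.2 > 0))} = 0
    ↔ (pb ≤ 0 ∧ pa ≥ pb) := by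
  constructor
  · contrapose!
    intro hp
    by_cases hab : 0 < pa ∧ 0 < pb
    · obtain ⟨ha, hb⟩ := hab
      refine volume_ne_zero_of_Ioo_prod_subset (lt_min ha one_pos) (lt_min hb one_pos) ?_
      rintro ⟨x, y⟩ ⟨⟨hx0, hx⟩, hy0, hy⟩
      obtain ⟨hxa, hx1⟩ := lt_min_iff.1 hx
      obtain ⟨hyb, hy1⟩ := lt_min_iff.1 hy
      exact ⟨⟨⟨hx0.le, hx1.le⟩, hy0.le, hy1.le⟩,
        Or.inr ⟨sub_neg.2 hxa, sub_neg.2 hyb, lt_max_of_lt_left hx0⟩⟩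
    · have ha : pa ≤ 0 ∧ pa < pb := by
        rcases le_or_gt pb 0 with hb | hb
        · have := hp hb
          constructor <;> linarith
        · have : pa ≤ 0 := not_lt.1 fun h => hab ⟨h, hb⟩
          constructor <;> linarith
      obtain ⟨δ, hδ, hδ'⟩ : ∃ δ : ℝ, 0 < δ ∧ δ < min ((pb - pa) / 3) (1 / 3) :=
        exists_between (lt_min (by linarith [ha.2]) (by norm_num))
      obtain ⟨hδp, hδ1⟩ := lt_min_iff.1 hδ'
      refine volume_ne_zero_of_Ioo_prod_subset (a := δ) (b := 2 * δ) (c := 2 * δ) (d := 3 * δ)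
        (by linarith) (by linarith) ?_
      rintro ⟨x, y⟩ ⟨⟨hx0, hx⟩, hy0, hy⟩
      dsimp only at hx0 hx hy0 hy
      refine ⟨⟨⟨?_, ?_⟩, ?_, ?_⟩, Or.inl ⟨?_, ?_, ?_⟩⟩ <;> dsimp only <;> linarith [ha.1]
  · rintro ⟨hb, hab⟩
    convert measure_empty (μ := (volume : Measure (ℝ × ℝ)))
    refine Set.eq_empty_of_forall_notMem ?_
    rintro ⟨x, y⟩ ⟨⟨-, hy, -⟩, ⟨h₁, -, h₂⟩ | ⟨-, h, -⟩⟩ <;> dsimp only at * <;> linarith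
end

section
/- (Positive profit without trading-up opportunities: mixed varieties, uniform values.) Consider the mixed setting with rental variety a, durable (absorbing) variety b, and initial state o, with value profiles uniformly distributed on [0,1]². Fix p_a ∈ (0,1) and the price profile p = (p_a, 0). Then: (i) the set of v ∈ [0,1]² that are trading-up types at p — i.e. those whose unique static optimum is a while v_b > v_a, or whose unique static optimum is o while max{v_a, v_b} > 0 — has Lebesgue measure zero; and (ii) the static profit at p equals p_a times the Lebesgue measure of {v ∈ [0,1]² : v_a − p_a > v_b}, which equals p_a·(1 − p_a)²/2 > 0. -/
open MeasureTheory

/-- The triangle of points of the unit square below the line `y = x - c`. -/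
lemma volume_unitSquare_sub_gt {c : ℝ} (hc : c ∈ Set.Icc (0 : ℝ) 1) :
    volume {v : ℝ × ℝ | (v.1 ∈ Set.Icc (0 : ℝ) 1 ∧ v.2 ∈ Set.Icc (0 : ℝ) 1) ∧ v.1 - c > v.2} =
      ENNReal.ofReal ((1 - c) ^ 2 / 2) := by
  obtain ⟨h0, h1⟩ := hc
  have hmeas : MeasurableSet
      {v : ℝ × ℝ | (v.1 ∈ Set.Icc (0 : ℝ) 1 ∧ v.2 ∈ Set.Icc (0 : ℝ) 1) ∧ v.1 - c > v.2} :=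
    ((measurable_fst measurableSet_Icc).inter (measurable_snd measurableSet_Icc)).inter
      (measurableSet_lt measurable_snd (measurable_fst.sub_const c))
  have hsection (x : ℝ) : volume (Prod.mk x ⁻¹'
      {v : ℝ × ℝ | (v.1 ∈ Set.Icc (0 : ℝ) 1 ∧ v.2 ∈ Set.Icc (0 : ℝ) 1) ∧ v.1 - c > v.2}) =
      (Set.Ioc c 1).indicator (fun x ↦ ENNReal.ofReal (x - c)) x := by
    by_cases hx : x ∈ Set.Ioc c 1
    · rw [Set.indicator_of_mem hx]
      have : Prod.mk x ⁻¹' {v : ℝ × ℝ | (v.1 ∈ Set.Icc (0 : ℝ) 1 ∧ v.2 ∈ Set.Icc (0 : ℝ) 1) ∧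
          v.1 - c > v.2} = Set.Ico 0 (x - c) := by
        ext y
        simp only [Set.mem_preimage, Set.mem_ofPred_eq, Set.mem_Icc, Set.mem_Ico, Set.mem_Ioc] at *
        constructor
        · rintro ⟨⟨-, hy, -⟩, h⟩
          exact ⟨hy, h⟩
        · rintro ⟨hy, h⟩
          exact ⟨⟨⟨by linarith, hx.2⟩, hy, by linarith⟩, h⟩
      rw [this, Real.volume_Ico, sub_zero]
    · rw [Set.indicator_of_notMem hx]
      convert measure_empty (μ := (volume : Measure ℝ))
      refine Set.eq_empty_of_forall_notMem fun y hy ↦ hx ?_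
      obtain ⟨⟨hx', hy'⟩, h⟩ := hy
      exact ⟨by linarith [hy'.1], hx'.2⟩
  rw [Measure.volume_eq_prod, Measure.prod_apply hmeas]
  simp_rw [hsection]
  rw [lintegral_indicator measurableSet_Ioc, ← ofReal_integral_eq_lintegral_ofReal,
    ← intervalIntegral.integral_of_le h1]
  · congr 1
    simp
    ring
  · exact (continuous_id.sub continuous_const).integrableOn_Ioc
  · filter_upwards [ae_restrict_mem measurableSet_Ioc] with x hx
    exact sub_nonneg.2 hx.1.le

/-- Positive profit without trading-up opportunities: mixed varieties (rental
`a`, durable `b`), uniform values on the unit square, price profile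
`p = (p_a, 0)` with `p_a ∈ (0,1)`. -/
theorem mixed_varieties_positive_profit (pa : ℝ) (hpa : pa ∈ Set.Ioo (0:ℝ) 1) :
    volume {v : ℝ × ℝ | (v.1 ∈ Set.Icc (0:ℝ) 1 ∧ v.2 ∈ Set.Icc (0:ℝ) 1) ∧
        ((v.1 - pa > v.2 - 0 ∧ v.1 - pa > 0 ∧ v.2 > v.1) ∨
          ((0:ℝ) > v.1 - pa ∧ (0:ℝ) > v.2 - 0 ∧ max v.1 v.2 > 0))} = 0 ∧
    pa * (volume {v : ℝ × ℝ | (v.1 ∈ Set.Icc (0:ℝ) 1 ∧ v.2 ∈ Set.Icc (0:ℝ) 1) ∧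
        v.1 - pa > v.2}).toReal = pa * (1 - pa) ^ 2 / 2 ∧
    pa * (1 - pa) ^ 2 / 2 > 0 := by
  have hpos : 0 < 1 - pa := sub_pos.2 hpa.2
  refine ⟨?_, ?_, ?_⟩
  · convert measure_empty (μ := (volume : Measure (ℝ × ℝ)))
    refine Set.eq_empty_of_forall_notMem ?_
    rintro v ⟨⟨-, hb⟩, ⟨h, -, h'⟩ | ⟨-, h, -⟩⟩
    · linarith [hpa.1]
    · linarith [hb.1]
  · rw [volume_unitSquare_sub_gt (Set.Ioo_subset_Icc_self hpa),
      ENNReal.toReal_ofReal (by positivity), mul_div_assoc]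
  · have := hpa.1
    positivity
end

section
/- (Zero-profit bound for two rentals with full support.) Consider the two-rentals setting with value profiles uniformly distributed on [0,1]². If a price profile p = (p_a, p_b) ∈ ℝ² is such that the set of misallocated types has Lebesgue measure zero — where v ∈ [0,1]² is misallocated at p if it has a unique static optimum s ∈ {a, b, o} (maximizing u_a = v_a − p_a, u_b = v_b − p_b, u_o = 0) whose value w_s is strictly below max{v_a, v_b, 0} — then the static profit at p, namely p_a times the measure of types uniquely choosing a plus p_b times the measure of types uniquely choosing b, is at most zero. -/
open MeasureTheory

/-- A null subset of the plane contains no nondegenerate open rectangle. -/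
theorem not_Ioo_prod_subset_of_volume_eq_zero {S : Set (ℝ × ℝ)} (hS : volume S = 0)
    {a b c d : ℝ} (hab : a < b) (hcd : c < d) : ¬ Set.Ioo a b ×ˢ Set.Ioo c d ⊆ S := fun hsub =>
  ((isOpen_Ioo.prod isOpen_Ioo).measure_pos volume
    ((Set.nonempty_Ioo.2 hab).prod (Set.nonempty_Ioo.2 hcd))).ne' (measure_mono_null hsub hS)

/-- Zero-profit bound for two rentals with full support: if the misallocated
types have Lebesgue measure zero, the static profit is at most zero. -/
theorem two_rentals_zero_profit (pa pb : ℝ)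
    (h : volume {v : ℝ × ℝ | (v.1 ∈ Set.Icc (0:ℝ) 1 ∧ v.2 ∈ Set.Icc (0:ℝ) 1) ∧
      ((v.1 - pa > v.2 - pb ∧ v.1 - pa > 0 ∧ v.1 < max v.1 (max v.2 0)) ∨
        (v.2 - pb > v.1 - pa ∧ v.2 - pb > 0 ∧ v.2 < max v.1 (max v.2 0)) ∨
        ((0:ℝ) > v.1 - pa ∧ (0:ℝ) > v.2 - pb ∧ (0:ℝ) < max v.1 (max v.2 0)))} = 0) :
    pa * (volume {v : ℝ × ℝ | (v.1 ∈ Set.Icc (0:ℝ) 1 ∧ v.2 ∈ Set.Icc (0:ℝ) 1) ∧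
        v.1 - pa > v.2 - pb ∧ v.1 - pa > 0}).toReal
      + pb * (volume {v : ℝ × ℝ | (v.1 ∈ Set.Icc (0:ℝ) 1 ∧ v.2 ∈ Set.Icc (0:ℝ) 1) ∧
        v.2 - pb > v.1 - pa ∧ v.2 - pb > 0}).toReal ≤ 0 := by
  have hpa : pa ≤ 0 := by
    by_contra! ha
    rcases le_or_gt pb 0 with hb | hb
    · obtain ⟨d, hd0, hd1, hd⟩ : ∃ d : ℝ, 0 < d ∧ d ≤ 1 ∧ d ≤ pa :=
        ⟨min 1 pa, by positivity, min_le_left _ _, min_le_right _ _⟩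
      refine not_Ioo_prod_subset_of_volume_eq_zero h (half_lt_self hd0) (half_pos hd0) ?_
      rintro ⟨x, y⟩ ⟨⟨hx, hx'⟩, hy, hy'⟩
      dsimp only at hx hx' hy hy'
      refine ⟨⟨⟨?_, ?_⟩, ?_, ?_⟩, Or.inr <| Or.inl ⟨?_, ?_, lt_max_of_lt_left ?_⟩⟩ <;>
        dsimp only <;> linarith
    · obtain ⟨d, hd0, hd1, hda, hdb⟩ : ∃ d : ℝ, 0 < d ∧ d ≤ 1 ∧ d ≤ pa ∧ d ≤ pb :=
        ⟨min 1 (min pa pb), by positivity, by simp, by simp, by simp⟩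
      refine not_Ioo_prod_subset_of_volume_eq_zero h hd0 hd0 ?_
      rintro ⟨x, y⟩ ⟨⟨hx, hx'⟩, hy, hy'⟩
      dsimp only at hx hx' hy hy'
      refine ⟨⟨⟨?_, ?_⟩, ?_, ?_⟩, Or.inr <| Or.inr ⟨?_, ?_, lt_max_of_lt_left ?_⟩⟩ <;>
        dsimp only <;> linarith
  have hpb : pb ≤ 0 := by
    by_contra! hb
    obtain ⟨d, hd0, hd1, hd⟩ : ∃ d : ℝ, 0 < d ∧ d ≤ 1 ∧ d ≤ pb :=
      ⟨min 1 pb, by positivity, min_le_left _ _, min_le_right _ _⟩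
    refine not_Ioo_prod_subset_of_volume_eq_zero h (half_pos hd0) (half_lt_self hd0) ?_
    rintro ⟨x, y⟩ ⟨⟨hx, hx'⟩, hy, hy'⟩
    dsimp only at hx hx' hy hy'
    refine ⟨⟨⟨?_, ?_⟩, ?_, ?_⟩,
      Or.inl ⟨?_, ?_, lt_max_of_lt_right (lt_max_of_lt_left ?_)⟩⟩ <;>
      dsimp only <;> linarith
  exact add_nonpos (mul_nonpos_of_nonpos_of_nonneg hpa ENNReal.toReal_nonneg)
    (mul_nonpos_of_nonpos_of_nonneg hpb ENNReal.toReal_nonneg)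
end
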